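/- Let C be an [n,k] linear code over a field F that is locally 2-reconstructible with locality r, let B0 be the subspace of C^⊥ spanned by all codewords of C^⊥ of Hamming weight at most r+1, and set b = ⌈2n/(r+2)⌉. Define the sequence e_1,…,e_b recursively by e_b = n and e_{m−1} = e_m − ⌈2 e_m / m⌉ + (r+1) for 2 ≤ m ≤ b. Then: (i) the first b generalized Hamming weights of B0 (and hence of C^⊥) satisfy d_m(B0) ≤ e_m for 1 ≤ m ≤ b; and (ii) if ℓ is an integer with 1 ≤ ℓ ≤ b−1 satisfying e_ℓ < k+ℓ < e_{ℓ+1}, then the k-th gap of B0 satisfies g_k(B0) ≥ k + ℓ, and the minimum distance of C satisfies d_min(C) ≤ n + 1 − (k + ℓ). -/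

import Mathlib

open Classical in
/-- The support of a vector: the set of coordinates where it is nonzero. -/
noncomputable def vsupp {F : Type*} [Field F] {n : ℕ} (v : Fin n → F) : Finset (Fin n) :=
  Finset.univ.filter (fun i => v i ≠ 0)

open Classical in
/-- The support of a subspace: the union of the supports of its vectors. -/
noncomputable def codeSupp {F : Type*} [Field F] {n : ℕ}
    (D : Submodule F (Fin n → F)) : Finset (Fin n) :=
  Finset.univ.filter (fun i => ∃ v ∈ D, v i ≠ 0)

/-- The dual code w.r.t. the standard bilinear form `⟨x,y⟩ = ∑ x i * y i`. -/
def dualCode {F : Type*} [Field F] {n : ℕ} (C : Submodule F (Fin n → F)) :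
    Submodule F (Fin n → F) where
  carrier := {w | ∀ v ∈ C, ∑ i, v i * w i = 0}
  zero_mem' := by intro v _; simp
  add_mem' := by
    intro a b ha hb v hv
    have h : ∑ i, v i * (a + b) i = (∑ i, v i * a i) + ∑ i, v i * b i := by
      simp [mul_add, Finset.sum_add_distrib]
    rw [h, ha v hv, hb v hv, add_zero]
  smul_mem' := by
    intro c a ha v hv
    have h : ∑ i, v i * (c • a) i = c * ∑ i, v i * a i := by
      simp [Finset.mul_sum, mul_left_comm]
    rw [h, ha v hv, mul_zero]

/-- The `i`-th generalized Hamming weight (1-indexed): the minimum support cardinality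
of an `i`-dimensional subspace. -/
noncomputable def ghw {F : Type*} [Field F] {n : ℕ} (C : Submodule F (Fin n → F)) (i : ℕ) : ℕ :=
  sInf {s | ∃ D : Submodule F (Fin n → F), D ≤ C ∧ Module.finrank F D = i ∧ (codeSupp D).card = s}

/-- The set of gaps of a code: elements of `{1,…,n}` that are not generalized Hamming weights. -/
noncomputable def gapSet {F : Type*} [Field F] {n : ℕ} (C : Submodule F (Fin n → F)) : Finset ℕ :=
  (Finset.Icc 1 n) \ ((Finset.Icc 1 (Module.finrank F C)).image (ghw C))

/-- The `i`-th gap of a code (1-indexed), via the increasing enumeration of the gap set. -/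
noncomputable def gapNum {F : Type*} [Field F] {n : ℕ} (C : Submodule F (Fin n → F)) (i : ℕ) : ℕ :=
  ((gapSet C).sort (· ≤ ·)).getD (i - 1) 0

/-- The minimum distance of a code: the minimum Hamming weight of a nonzero codeword. -/
noncomputable def dmin {F : Type*} [Field F] {n : ℕ} (C : Submodule F (Fin n → F)) : ℕ :=
  sInf {w | ∃ v ∈ C, v ≠ 0 ∧ (vsupp v).card = w}

/-- `S` is an `ℓ`-core (`ℓ = S.card`) of `B` if no nonzero codeword of `B`
has its support contained in `S`. -/
def isCore {F : Type*} [Field F] {n : ℕ} (B : Submodule F (Fin n → F)) (S : Finset (Fin n)) : Prop :=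
  ∀ v ∈ B, v ≠ 0 → ¬ (vsupp v ⊆ S)

/-- The subspace of the dual code spanned by all its codewords of Hamming weight `≤ r+1`. -/
noncomputable def lowWtSpan {F : Type*} [Field F] {n : ℕ}
    (C : Submodule F (Fin n → F)) (r : ℕ) : Submodule F (Fin n → F) :=
  Submodule.span F {c | c ∈ dualCode C ∧ (vsupp c).card ≤ r + 1}

/-- `A_i`: the set of local parities covering coordinate `i`, i.e. dual codewords of
Hamming weight at most `r+1` whose support contains `i`. -/
def coveringParities {F : Type*} [Field F] {n : ℕ}
    (C : Submodule F (Fin n → F)) (r : ℕ) (i : Fin n) : Set (Fin n → F) :=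
  {c | c ∈ dualCode C ∧ (vsupp c).card ≤ r + 1 ∧ c i ≠ 0}

/-- `C` is locally 2-reconstructible with locality `r`: every `A_i` is nonempty
and `A_i ≠ A_j` for `i ≠ j`. -/
def Locally2Recon {F : Type*} [Field F] {n : ℕ}
    (C : Submodule F (Fin n → F)) (r : ℕ) : Prop :=
  (∀ i : Fin n, (coveringParities C r i).Nonempty) ∧
  (∀ i j : Fin n, i ≠ j → coveringParities C r i ≠ coveringParities C r j)

section Helpers

open Finset Module

variable {F : Type*} [Field F] {n : ℕ}

lemma mem_vsupp {v : Fin n → F} {i : Fin n} : i ∈ vsupp v ↔ v i ≠ 0 := by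
  simp [vsupp]

lemma mem_codeSupp {D : Submodule F (Fin n → F)} {i : Fin n} :
    i ∈ codeSupp D ↔ ∃ v ∈ D, v i ≠ 0 := by
  simp [codeSupp]

lemma codeSupp_mono {D E : Submodule F (Fin n → F)} (h : D ≤ E) : codeSupp D ⊆ codeSupp E := by
  intro i hi
  obtain ⟨v, hv, hvi⟩ := mem_codeSupp.1 hi
  exact mem_codeSupp.2 ⟨v, h hv, hvi⟩

lemma codeSupp_span_subset (T : Finset (Fin n → F)) :
    codeSupp (Submodule.span F (T : Set (Fin n → F))) ⊆ T.biUnion vsupp := by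
  intro i hi
  obtain ⟨v, hv, hvi⟩ := mem_codeSupp.1 hi
  by_contra hcon
  refine hvi ?_
  induction hv using Submodule.span_induction with
  | mem w hw =>
    by_contra hwi
    exact hcon (mem_biUnion.2 ⟨w, hw, mem_vsupp.2 hwi⟩)
  | zero => rfl
  | add x y _ _ hx hy => by_cases h1 : x i = 0 <;> by_cases h2 : y i = 0 <;> simp_all
  | smul a x _ hx => by_cases h1 : x i = 0 <;> simp_all

lemma ghw_le_card_codeSupp {C D : Submodule F (Fin n → F)} (h : D ≤ C) :
    ghw C (finrank F D) ≤ (codeSupp D).card :=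
  Nat.sInf_le ⟨D, h, rfl, rfl⟩

lemma exists_card_codeSupp_eq_ghw (C : Submodule F (Fin n → F)) {i : ℕ} (hi : i ≤ finrank F C) :
    ∃ D ≤ C, finrank F D = i ∧ (codeSupp D).card = ghw C i := by
  obtain ⟨f, hf⟩ := exists_linearIndependent_of_le_finrank hi
  have hli : LinearIndependent F fun a => (f a : Fin n → F) :=
    hf.map' C.subtype C.ker_subtype
  have hD : Submodule.span F (Set.range fun a => (f a : Fin n → F)) ≤ C :=
    Submodule.span_le.2 (Set.range_subset_iff.2 fun a => (f a).2)
  exact Nat.sInf_mem (s := {s | ∃ D : Submodule F (Fin n → F), D ≤ C ∧ finrank F D = i ∧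
    (codeSupp D).card = s})
    ⟨_, _, hD, (finrank_span_eq_card hli).trans (Fintype.card_fin i), rfl⟩

/-- Shortening a nonzero code at a coordinate of its support lowers the dimension by one. -/
lemma finrank_inf_ker_proj (D : Submodule F (Fin n → F)) {j : Fin n} (hj : j ∈ codeSupp D) :
    finrank F ↥(D ⊓ LinearMap.ker (LinearMap.proj j : (Fin n → F) →ₗ[F] F)) + 1 =
      finrank F D := by
  set p : (Fin n → F) →ₗ[F] F := LinearMap.proj j
  obtain ⟨v, hv, hvj⟩ := mem_codeSupp.1 hj
  have hlt : D ⊓ LinearMap.ker p < D :=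
    inf_le_left.lt_of_not_ge fun h => hvj (by simpa [p] using (h hv).2)
  have h1 := Submodule.finrank_lt_finrank_of_lt hlt
  have h2 := Submodule.finrank_sup_add_finrank_inf_eq D (LinearMap.ker p)
  have h3 := LinearMap.finrank_range_add_finrank_ker p
  have h4 := (LinearMap.range p).finrank_le
  have h5 := (D ⊔ LinearMap.ker p).finrank_le
  rw [finrank_self] at h4
  omega

lemma ghw_lt_ghw_succ (C : Submodule F (Fin n → F)) {i : ℕ} (hi : i + 1 ≤ finrank F C) :
    ghw C i < ghw C (i + 1) := by
  obtain ⟨D, hDC, hD, hcard⟩ := exists_card_codeSupp_eq_ghw C hi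
  obtain ⟨v, hv, hv0⟩ : ∃ v ∈ D, v ≠ 0 := D.exists_mem_ne_zero_of_ne_bot fun h => by
    rw [h, finrank_bot] at hD
    omega
  obtain ⟨j, hvj⟩ := Function.ne_iff.1 hv0
  have hj : j ∈ codeSupp D := mem_codeSupp.2 ⟨v, hv, hvj⟩
  have hdim := finrank_inf_ker_proj D hj
  set E := D ⊓ LinearMap.ker (LinearMap.proj j : (Fin n → F) →ₗ[F] F)
  have hE : finrank F E = i := by omega
  have hss : codeSupp E ⊂ codeSupp D := by
    refine (codeSupp_mono inf_le_left).ssubset_of_not_subset fun h => ?_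
    obtain ⟨w, hw, hwj⟩ := mem_codeSupp.1 (h hj)
    exact hwj hw.2
  rw [← hcard, ← hE]
  exact (ghw_le_card_codeSupp (inf_le_left.trans hDC)).trans_lt (card_lt_card hss)

lemma ghw_strictMonoOn (C : Submodule F (Fin n → F)) :
    StrictMonoOn (ghw C) (Set.Iic (finrank F C)) := by
  intro i _ j hj hij
  simp only [Set.mem_Iic] at hj
  induction j, hij using Nat.le_induction with
  | base => exact ghw_lt_ghw_succ C hj
  | succ j _ ih => exact (ih (by omega)).trans (ghw_lt_ghw_succ C hj)

lemma ghw_anti {B C : Submodule F (Fin n → F)} (h : B ≤ C) {i : ℕ} (hi : i ≤ finrank F B) :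
    ghw C i ≤ ghw B i := by
  obtain ⟨D, hD, rfl, hcard⟩ := exists_card_codeSupp_eq_ghw B hi
  exact hcard ▸ ghw_le_card_codeSupp (hD.trans h)

lemma finrank_add_finrank_le_of_le_dualCode {W D : Submodule F (Fin n → F)}
    (h : W ≤ dualCode D) : finrank F W + finrank F D ≤ n := by
  have hmap : W.map (dotProductEquiv F (Fin n)).toLinearMap ≤ D.dualAnnihilator := by
    rintro _ ⟨w, hw, rfl⟩
    rw [Submodule.mem_dualAnnihilator]
    intro v hv
    simpa [dotProduct, mul_comm] using h hw v hv
  have h1 := Submodule.finrank_mono hmap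
  have h2 := Subspace.finrank_add_finrank_dualAnnihilator_eq D
  have h3 : finrank F (W.map (dotProductEquiv F (Fin n)).toLinearMap) = finrank F W :=
    LinearEquiv.finrank_map_eq _ _
  rw [finrank_fin_fun] at h2
  omega

lemma le_dualCode_comm {W D : Submodule F (Fin n → F)} (h : W ≤ dualCode D) :
    D ≤ dualCode W := fun v hv w hw => by
  simpa only [mul_comm] using h hw v hv

/-- A code whose dual has a subspace of dimension `i` supported in `S` has a nonzero codeword
vanishing on `S` as soon as its dimension exceeds `|S| - i`. -/
lemma exists_codeword_vanishing {C D : Submodule F (Fin n → F)} (hD : D ≤ dualCode C)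
    {S : Finset (Fin n)} (hS : codeSupp D ⊆ S)
    (hcard : S.card < finrank F C + finrank F D) :
    ∃ v ∈ C, v ≠ 0 ∧ ∀ i ∈ S, v i = 0 := by
  set ρ : (Fin n → F) →ₗ[F] (S → F) := LinearMap.funLeft F F Subtype.val
  have hker : ∀ v, v ∈ LinearMap.ker ρ ↔ ∀ i ∈ S, v i = 0 := fun v => by
    simp [ρ, LinearMap.mem_ker, funext_iff, LinearMap.funLeft_apply]
  have hsup : C ⊔ LinearMap.ker ρ ≤ dualCode D := by
    refine sup_le (le_dualCode_comm hD) fun w hw v hv => sum_eq_zero fun i _ => ?_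
    by_cases hi : i ∈ S
    · rw [(hker w).1 hw i hi, mul_zero]
    · have : v i = 0 := by
        by_contra hvi
        exact hi (hS (mem_codeSupp.2 ⟨v, hv, hvi⟩))
      rw [this, zero_mul]
  have h1 := finrank_add_finrank_le_of_le_dualCode hsup
  have h2 := Submodule.finrank_sup_add_finrank_inf_eq C (LinearMap.ker ρ)
  have h3 := LinearMap.finrank_range_add_finrank_ker ρ
  have h4 := (LinearMap.range ρ).finrank_le
  rw [finrank_fintype_fun_eq_card, Fintype.card_coe] at h4
  rw [finrank_fin_fun] at h3
  obtain ⟨v, hv, hv0⟩ := (C ⊓ LinearMap.ker ρ).exists_mem_ne_zero_of_ne_bot fun h => by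
    rw [h, finrank_bot] at h2
    omega
  exact ⟨v, hv.1, hv0, (hker v).1 hv.2⟩

lemma dmin_le_of_ghw_lt {C B : Submodule F (Fin n → F)} (hB : B ≤ dualCode C) {i N : ℕ}
    (hi : i ≤ finrank F B) (hN : ghw B i < N) (hNn : N ≤ n + 1) (hNC : N ≤ finrank F C + i) :
    dmin C ≤ n + 1 - N := by
  obtain ⟨D, hDB, rfl, hcard⟩ := exists_card_codeSupp_eq_ghw B hi
  obtain ⟨S, hDS, hS⟩ := exists_superset_card_eq (s := codeSupp D) (n := N - 1)
    (by omega) (by rw [Fintype.card_fin]; omega)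
  obtain ⟨v, hvC, hv0, hvS⟩ := exists_codeword_vanishing (hDB.trans hB) hDS (by omega)
  have hsub : vsupp v ⊆ Sᶜ := fun i hi => mem_compl.2 fun hiS => mem_vsupp.1 hi (hvS i hiS)
  have h1 := card_le_card hsub
  rw [card_compl, Fintype.card_fin] at h1
  have h2 : dmin C ≤ (vsupp v).card := Nat.sInf_le ⟨v, hvC, hv0, rfl⟩
  omega

lemma le_sort_getD_of_card_filter_lt (s : Finset ℕ) {k N : ℕ} (hk : 1 ≤ k) (hks : k ≤ s.card)
    (h : (s.filter (· < N)).card < k) : N ≤ (s.sort (· ≤ ·)).getD (k - 1) 0 := by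
  have hlen : k - 1 < (s.sort (· ≤ ·)).length := by rw [length_sort]; omega
  let x : Fin s.card := ⟨k - 1, by omega⟩
  have hx : (s.sort (· ≤ ·)).getD (k - 1) 0 = s.orderEmbOfFin rfl x := by
    rw [List.getD_eq_getElem _ _ hlen, orderEmbOfFin_apply]
    rfl
  rw [hx]
  by_contra! hlt
  have hsub : (Iic x).map (s.orderEmbOfFin rfl).toEmbedding ⊆ s.filter (· < N) := by
    intro y hy
    obtain ⟨z, hz, rfl⟩ := mem_map.1 hy
    refine mem_filter.2 ⟨orderEmbOfFin_mem s rfl z, lt_of_le_of_lt ?_ hlt⟩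
    exact (s.orderEmbOfFin rfl).monotone (mem_Iic.1 hz)
  have hle := card_le_card hsub
  rw [card_map, Fin.card_Iic] at hle
  simp only [x] at hle
  omega

lemma le_gapNum_of_ghw_lt {B : Submodule F (Fin n → F)} {i k : ℕ} (hk : 1 ≤ k)
    (hkB : k + finrank F B ≤ n) (hi : i ≤ finrank F B) (h : ghw B i < k + i) :
    k + i ≤ gapNum B k := by
  have hmono := ghw_strictMonoOn B
  refine le_sort_getD_of_card_filter_lt _ hk ?_ ?_
  · have h1 := le_card_sdiff ((Icc 1 (finrank F B)).image (ghw B)) (Icc 1 n)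
    have h2 : ((Icc 1 (finrank F B)).image (ghw B)).card ≤ (Icc 1 (finrank F B)).card :=
      card_image_le
    simp only [Nat.card_Icc] at h1 h2
    unfold gapSet
    omega
  · have hinj : ((Icc 1 i).image (ghw B)).card = i := by
      rw [card_image_of_injOn, Nat.card_Icc, Nat.add_sub_cancel]
      refine hmono.injOn.mono fun j hj => ?_
      simp only [coe_Icc, Set.mem_Icc] at hj
      exact hj.2.trans hi
    have hsub : (Icc 1 i).image (ghw B) ⊆ Icc 1 (k + i - 1) := by
      intro y hy
      obtain ⟨j, hj, rfl⟩ := mem_image.1 hy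
      rw [mem_Icc] at hj
      have h0 : ghw B 0 < ghw B j := hmono (Nat.zero_le _) (hj.2.trans hi) hj.1
      have h1 : ghw B j ≤ ghw B i := hmono.monotoneOn (hj.2.trans hi) hi hj.2
      rw [mem_Icc]
      omega
    have hgap : (gapSet B).filter (· < k + i) ⊆
        Icc 1 (k + i - 1) \ (Icc 1 i).image (ghw B) := by
      intro y hy
      simp only [gapSet, mem_filter, mem_sdiff, mem_image, mem_Icc, not_exists, not_and] at hy ⊢
      exact ⟨by omega, fun j hj => hy.1.2 j ⟨hj.1, hj.2.trans hi⟩⟩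
    have := card_le_card hgap
    rw [card_sdiff_of_subset hsub, hinj, Nat.card_Icc] at this
    omega

open Classical in
/-- The coordinates covered by `v` and by no other member of `T`. -/
noncomputable def privateSupp (T : Finset (Fin n → F)) (v : Fin n → F) : Finset (Fin n) :=
  (vsupp v).filter fun i => ∀ w ∈ T, w i ≠ 0 → w = v

lemma mem_privateSupp {T : Finset (Fin n → F)} {v : Fin n → F} {i : Fin n} :
    i ∈ privateSupp T v ↔ v i ≠ 0 ∧ ∀ w ∈ T, w i ≠ 0 → w = v := by
  simp [privateSupp, mem_vsupp]

open Classical in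
lemma two_mul_card_biUnion_vsupp_le (T : Finset (Fin n → F)) :
    2 * (T.biUnion vsupp).card ≤
      ∑ v ∈ T, (vsupp v).card + ∑ v ∈ T, (privateSupp T v).card := by
  have hv : ∑ v ∈ T, (vsupp v).card = ∑ i, (T.filter fun v => i ∈ vsupp v).card := by
    simp only [card_eq_sum_ones, sum_filter]
    rw [sum_comm]
    refine sum_congr rfl fun v _ => ?_
    rw [← sum_filter, filter_mem_eq_inter, univ_inter]
  have hp : ∑ v ∈ T, (privateSupp T v).card =
      ∑ i, (T.filter fun v => i ∈ privateSupp T v).card := by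
    simp only [card_eq_sum_ones, sum_filter]
    rw [sum_comm]
    refine sum_congr rfl fun v _ => ?_
    rw [← sum_filter, filter_mem_eq_inter, univ_inter]
  rw [hv, hp, ← sum_add_distrib, mul_comm, ← smul_eq_mul]
  refine (card_nsmul_le_sum _ _ _ fun i hi => ?_).trans
    (sum_le_sum_of_subset (subset_univ (T.biUnion vsupp)))
  obtain ⟨v, hvT, hvi⟩ := mem_biUnion.1 hi
  have hmem : v ∈ T.filter fun v => i ∈ vsupp v := mem_filter.2 ⟨hvT, hvi⟩
  by_cases hpriv : i ∈ privateSupp T v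
  · have h1 := card_pos.2 ⟨v, hmem⟩
    have h2 := card_pos.2 ⟨v, (mem_filter (p := fun v => i ∈ privateSupp T v)).2 ⟨hvT, hpriv⟩⟩
    omega
  · obtain ⟨w, hwT, hwi, hwv⟩ : ∃ w ∈ T, w i ≠ 0 ∧ w ≠ v := by
      by_contra! hcon
      exact hpriv (mem_privateSupp.2 ⟨mem_vsupp.1 hvi, hcon⟩)
    have := one_lt_card.2 ⟨w, mem_filter.2 ⟨hwT, mem_vsupp.2 hwi⟩, v, hmem, hwv⟩
    omega

open Classical in
/-- Among words of weight at most `s`, some word can be removed so that the union of the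
supports shrinks by at least twice its size over the number of words, minus `s`. -/
lemma exists_erase_card_biUnion_vsupp {T : Finset (Fin n → F)} (hT : T.Nonempty) {s : ℕ}
    (hs : ∀ v ∈ T, (vsupp v).card ≤ s) :
    ∃ v ∈ T, ∃ u, 2 * (T.biUnion vsupp).card ≤ T.card * (s + u) ∧
      ((T.erase v).biUnion vsupp).card + u ≤ (T.biUnion vsupp).card := by
  obtain ⟨v, hvT, hv⟩ := exists_max_image T (fun v => (privateSupp T v).card) hT
  refine ⟨v, hvT, (privateSupp T v).card, ?_, ?_⟩
  · have h1 := two_mul_card_biUnion_vsupp_le T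
    have h2 := sum_le_card_nsmul T (fun v => (vsupp v).card) s hs
    have h3 := sum_le_card_nsmul T (fun v => (privateSupp T v).card) _ hv
    simp only [smul_eq_mul] at h2 h3
    rw [mul_add]
    omega
  · rw [← card_union_of_disjoint]
    · refine card_le_card (union_subset (biUnion_subset_biUnion_of_subset_left _
        (erase_subset _ _)) fun i hi => ?_)
      exact mem_biUnion.2 ⟨v, hvT, mem_vsupp.2 (mem_privateSupp.1 hi).1⟩
    · refine disjoint_left.2 fun i hi hp => ?_
      obtain ⟨w, hw, hwi⟩ := mem_biUnion.1 hi
      exact (mem_erase.1 hw).1 ((mem_privateSupp.1 hp).2 w (mem_erase.1 hw).2 (mem_vsupp.1 hwi))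

lemma mul_comm_of_mem_span_of_mem_privateSupp {T : Finset (Fin n → F)} {v c : Fin n → F}
    {i j : Fin n} (hi : i ∈ privateSupp T v) (hj : j ∈ privateSupp T v)
    (hc : c ∈ Submodule.span F (T : Set (Fin n → F))) : c i * v j = v i * c j := by
  induction hc using Submodule.span_induction with
  | mem w hw =>
    by_cases hwv : w = v
    · rw [hwv]
    · have h1 : w i = 0 := by
        by_contra h
        exact hwv ((mem_privateSupp.1 hi).2 w hw h)
      have h2 : w j = 0 := by
        by_contra h
        exact hwv ((mem_privateSupp.1 hj).2 w hw h)
      rw [h1, h2, zero_mul, mul_zero]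
  | zero => simp
  | add x y _ _ hx hy => simp only [Pi.add_apply, add_mul, mul_add, hx, hy]
  | smul a x _ hx => simp only [Pi.smul_apply, smul_eq_mul, mul_assoc, hx, mul_left_comm]

lemma card_privateSupp_le_one {C : Submodule F (Fin n → F)} {r : ℕ} (hloc : Locally2Recon C r)
    {T : Finset (Fin n → F)} (hT : Submodule.span F (T : Set (Fin n → F)) = lowWtSpan C r)
    (v : Fin n → F) : (privateSupp T v).card ≤ 1 := by
  refine card_le_one.2 fun i hi j hj => ?_
  by_contra hij
  refine hloc.2 i j hij (Set.ext fun c => and_congr_right fun hcC => and_congr_right fun hcr => ?_)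
  have hc : c ∈ Submodule.span F (T : Set (Fin n → F)) :=
    hT ▸ Submodule.subset_span ⟨hcC, hcr⟩
  have heq := mul_comm_of_mem_span_of_mem_privateSupp hi hj hc
  have hvi := (mem_privateSupp.1 hi).1
  have hvj := (mem_privateSupp.1 hj).1
  refine not_congr ⟨fun h => ?_, fun h => ?_⟩ <;> simp_all

lemma biUnion_vsupp_eq_univ {C : Submodule F (Fin n → F)} {r : ℕ} (hloc : Locally2Recon C r)
    {T : Finset (Fin n → F)} (hT : Submodule.span F (T : Set (Fin n → F)) = lowWtSpan C r) :
    T.biUnion vsupp = univ := by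
  refine eq_univ_of_forall fun i => codeSupp_span_subset T ?_
  obtain ⟨c, hcC, hcr, hci⟩ := hloc.1 i
  exact mem_codeSupp.2 ⟨c, hT ▸ Submodule.subset_span ⟨hcC, hcr⟩, hci⟩

lemma two_mul_length_le {C : Submodule F (Fin n → F)} {r : ℕ} (hloc : Locally2Recon C r)
    {T : Finset (Fin n → F)} (hT : Submodule.span F (T : Set (Fin n → F)) = lowWtSpan C r)
    (hr : ∀ v ∈ T, (vsupp v).card ≤ r + 1) : 2 * n ≤ T.card * (r + 2) := by
  have h1 := two_mul_card_biUnion_vsupp_le T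
  have h2 := sum_le_card_nsmul T (fun v => (vsupp v).card) _ hr
  have h3 := sum_le_card_nsmul T (fun v => (privateSupp T v).card) _
    fun v _ => card_privateSupp_le_one hloc hT v
  rw [biUnion_vsupp_eq_univ hloc hT, card_univ, Fintype.card_fin] at h1
  simp only [smul_eq_mul] at h2 h3
  linarith

lemma lowWtSpan_le_dualCode (C : Submodule F (Fin n → F)) (r : ℕ) :
    lowWtSpan C r ≤ dualCode C :=
  Submodule.span_le.2 fun _ hc => hc.1

lemma exists_lowWt_basis (C : Submodule F (Fin n → F)) (r : ℕ) :
    ∃ T : Finset (Fin n → F), (∀ v ∈ T, v ∈ dualCode C ∧ (vsupp v).card ≤ r + 1) ∧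
      LinearIndepOn F id (T : Set (Fin n → F)) ∧
      Submodule.span F (T : Set (Fin n → F)) = lowWtSpan C r := by
  obtain ⟨s, hs, hspan, hli⟩ := exists_linearIndependent F
    {c : Fin n → F | c ∈ dualCode C ∧ (vsupp c).card ≤ r + 1}
  have hfin : s.Finite := hli.setFinite
  refine ⟨hfin.toFinset, fun v hv => hs (hfin.mem_toFinset.1 hv), ?_, ?_⟩
  · rw [hfin.coe_toFinset]
    exact hli
  · rw [hfin.coe_toFinset]
    exact hspan

/-- Successive removal of words from a family of low-weight words. -/
lemma exists_lowWt_family {b r : ℕ} {e : ℕ → ℤ}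
    (herec : ∀ m, 2 ≤ m → m ≤ b →
      e (m - 1) = e m - ⌈(2 * (e m : ℚ)) / (m : ℚ)⌉ + (r + 1))
    {T : Finset (Fin n → F)} (hr : ∀ v ∈ T, (vsupp v).card ≤ r + 1) (hTb : T.card = b)
    (heb : ((T.biUnion vsupp).card : ℤ) ≤ e b) {m : ℕ} (hm : 1 ≤ m) (hmb : m ≤ b) :
    ∃ T' ⊆ T, T'.card = m ∧ ((T'.biUnion vsupp).card : ℤ) ≤ e m := by
  classical
  induction hmb using Nat.decreasingInduction with
  | self => exact ⟨T, Subset.rfl, hTb, heb⟩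
  | of_succ m hmb ih =>
    obtain ⟨T', hT', hcard, hle⟩ := ih (by omega)
    obtain ⟨v, hv, u, hu, hu'⟩ := exists_erase_card_biUnion_vsupp
      (card_pos.1 (by omega : 0 < T'.card)) fun v hv => hr v (hT' hv)
    refine ⟨T'.erase v, (erase_subset _ _).trans hT', by rw [card_erase_of_mem hv]; omega, ?_⟩
    have hrec := herec (m + 1) (by omega) hmb
    rw [Nat.add_sub_cancel] at hrec
    have hceil : ⌈(2 * (e (m + 1) : ℚ)) / ((m + 1 : ℕ) : ℚ)⌉ ≤
        (r + 1 + u) + (e (m + 1) - (T'.biUnion vsupp).card) := by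
      rw [Int.ceil_le, div_le_iff₀ (by positivity)]
      rw [hcard] at hu
      have hm' : (1 : ℤ) ≤ m := by exact_mod_cast hm
      have key : 2 * e (m + 1) ≤
          ((r + 1 + u) + (e (m + 1) - (T'.biUnion vsupp).card)) * ((m + 1 : ℕ) : ℤ) := by
        zify at hu
        push_cast
        nlinarith
      exact_mod_cast key
    zify at hu'
    linarith

end Helpers

/-- Theorem 4 of the paper: for a locally 2-reconstructible `[n,k]`
code `C` with `b = ⌈2n/(r+2)⌉`, the first `b` GHWs of `B0` (and of `C^⊥`) satisfy
`d_m ≤ e_m`; and if `ℓ` satisfies `e_ℓ < k+ℓ < e_{ℓ+1}` then `g_k(B0) ≥ k+ℓ` and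
`d_min(C) ≤ n + 1 - (k+ℓ)`. -/
theorem stmt11 {F : Type*} [Field F] {n k r b : ℕ} (hr : 1 ≤ r)
    (C : Submodule F (Fin n → F)) (hC : Module.finrank F C = k) (hk1 : 1 ≤ k)
    (hloc : Locally2Recon C r)
    (hb : b = ⌈(2 * n : ℚ) / (r + 2)⌉₊)
    (e : ℕ → ℤ) (heb : e b = n)
    (herec : ∀ m, 2 ≤ m → m ≤ b →
      e (m - 1) = e m - ⌈(2 * (e m : ℚ)) / (m : ℚ)⌉ + (r + 1)) :
    (∀ m, 1 ≤ m → m ≤ b →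
      (ghw (lowWtSpan C r) m : ℤ) ≤ e m ∧ (ghw (dualCode C) m : ℤ) ≤ e m) ∧
    (∀ ℓ : ℕ, 1 ≤ ℓ → ℓ ≤ b - 1 →
      e ℓ < ((k + ℓ : ℕ) : ℤ) → ((k + ℓ : ℕ) : ℤ) < e (ℓ + 1) →
      k + ℓ ≤ gapNum (lowWtSpan C r) k ∧ dmin C ≤ n + 1 - (k + ℓ)) := by
  obtain ⟨T, hT, hli, hspan⟩ := exists_lowWt_basis C r
  have hwt : ∀ v ∈ T, (vsupp v).card ≤ r + 1 := fun v hv => (hT v hv).2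
  have hdim : Module.finrank F (lowWtSpan C r) = T.card :=
    hspan ▸ finrank_span_finset_eq_card hli
  have hbT : b ≤ T.card := by
    rw [hb, Nat.ceil_le, div_le_iff₀ (by positivity)]
    exact_mod_cast two_mul_length_le hloc hspan hwt
  have hkT := finrank_add_finrank_le_of_le_dualCode
    (le_dualCode_comm (lowWtSpan_le_dualCode C r))
  have hghw : ∀ m, 1 ≤ m → m ≤ b → (ghw (lowWtSpan C r) m : ℤ) ≤ e m := by
    intro m hm hmb
    obtain ⟨T₁, hT₁, hcard₁⟩ := Finset.exists_subset_card_eq hbT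
    obtain ⟨T', hT', rfl, hle⟩ := exists_lowWt_family herec (fun v hv => hwt v (hT₁ hv)) hcard₁
      (heb ▸ by exact_mod_cast card_finset_fin_le _) hm hmb
    have hTT : (T' : Set (Fin n → F)) ⊆ T := by exact_mod_cast hT'.trans hT₁
    have h1 := ghw_le_card_codeSupp (hspan ▸ Submodule.span_mono hTT :
      Submodule.span F (T' : Set (Fin n → F)) ≤ lowWtSpan C r)
    rw [finrank_span_finset_eq_card (hli.mono hTT)] at h1
    have h2 := Finset.card_le_card (codeSupp_span_subset T')
    exact le_trans (by exact_mod_cast h1.trans h2) hle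
  refine ⟨fun m hm hmb => ⟨hghw m hm hmb, le_trans ?_ (hghw m hm hmb)⟩, fun ℓ hℓ hℓb hlt _ => ?_⟩
  · exact_mod_cast ghw_anti (lowWtSpan_le_dualCode C r) (by omega)
  · have h1 : ghw (lowWtSpan C r) ℓ < k + ℓ := by
      exact_mod_cast (hghw ℓ hℓ (by omega)).trans_lt hlt
    exact ⟨le_gapNum_of_ghw_lt hk1 (by omega) (by omega) h1,
      dmin_le_of_ghw_lt (lowWtSpan_le_dualCode C r) (by omega) h1 (by omega) (by omega)⟩
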